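/- arXiv:2510.22165 — 2 statements merged into one kernel-verified Lean document; each statement's English description precedes it below -/
import Mathlib

section
/- Let S be a measurable space, let η be a measure on S, let β ∈ ℝ, and let h : S → ℝ be a measurable function that is integrable with respect to η. For a measure m on S (for which h is m-integrable) set Y(m) = exp( β ∫_S h dm ). Then for every q ≥ 1 and all points x_1, …, x_q ∈ S, Σ_{T ⊆ {1,…,q}} (−1)^{q − |T|} Y( η + Σ_{i ∈ T} δ_{x_i} ) = Y(η) · Π_{i=1}^q ( exp(β h(x_i)) − 1 ), where δ_x denotes the Dirac measure at x and the sum runs over all subsets T of {1,…,q}. -/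
open MeasureTheory

theorem integral_add_sum_dirac {S ι : Type*} [MeasurableSpace S] {η : Measure S} {h : S → ℝ}
    (hmeas : Measurable h) (hint : Integrable h η) (x : ι → S) (T : Finset ι) :
    ∫ s, h s ∂(η + ∑ i ∈ T, Measure.dirac (x i)) = ∫ s, h s ∂η + ∑ i ∈ T, h (x i) := by
  have hdirac : ∀ i ∈ T, Integrable h (Measure.dirac (x i)) := fun i _ =>
    integrable_dirac' hmeas.stronglyMeasurable enorm_lt_top
  rw [integral_add_measure hint (integrable_finsetSum_measure.2 hdirac),
    integral_finsetSum_measure hdirac]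
  simp only [integral_dirac' h _ hmeas.stronglyMeasurable]

/-- For `Y(m) = exp (β ∫ h dm)` and any points `x₁, …, x_q`, the
iterated difference operator evaluates as
`∑_{T ⊆ {1,…,q}} (-1)^{q - |T|} Y(η + ∑_{i ∈ T} δ_{x_i})
  = Y(η) ∏_{i=1}^q (exp (β h(x_i)) - 1)`. -/
theorem iterated_difference_of_exponential_functional
    {S : Type*} [MeasurableSpace S] (η : Measure S)
    (β : ℝ) (h : S → ℝ) (hmeas : Measurable h) (hint : Integrable h η)
    (q : ℕ) (hq : 1 ≤ q) (x : Fin q → S) :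
    ∑ T : Finset (Fin q),
        (-1 : ℝ) ^ (q - T.card)
          * Real.exp (β * ∫ s, h s ∂(η + ∑ i ∈ T, Measure.dirac (x i)))
      = Real.exp (β * ∫ s, h s ∂η) * ∏ i : Fin q, (Real.exp (β * h (x i)) - 1) := by
  simp_rw [sub_eq_add_neg (Real.exp _), Fintype.prod_add, Finset.mul_sum]
  refine Finset.sum_congr rfl fun T _ => ?_
  rw [integral_add_sum_dirac hmeas hint, mul_add, Real.exp_add, Finset.mul_sum, Real.exp_sum,
    Finset.prod_const, Finset.card_compl, Fintype.card_fin]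
  ring
end

section
/- Let D ⊆ ℂ be a bounded open set, identified with a subset of ℝ². Let ℛ be the (countable) collection of all subsets of D of the form (a₁, b₁] × (a₂, b₂] or [a₁, b₁) × [a₂, b₂) with rational endpoints a_i < b_i, whose closure is contained in D. Let (μ_k) be a sequence of finite Borel measures on D such that: (i) for every R ∈ ℛ the limit L(R) := lim_{k→∞} μ_k(R) exists; (ii) the limit L(D) := lim_{k→∞} μ_k(D) exists; and (iii) L(D) = sup{ Σ_{i=1}^m L(R_i) : m ≥ 1, R_1, …, R_m ∈ ℛ pairwise disjoint }. Then there exists a finite Borel measure μ on D such that μ_k converges weakly to μ, i.e. ∫_D φ dμ_k → ∫_D φ dμ for every bounded continuous φ : D → ℝ. -/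
open MeasureTheory Filter

/-- The countable collection `ℛ` of half-open rectangles with rational endpoints whose
closure is contained in `D` (identifying `ℂ` with `ℝ²` via real and imaginary parts). -/
def rationalRectanglesIn (D : Set ℂ) : Set (Set ℂ) :=
  {R | (∃ a₁ b₁ a₂ b₂ : ℚ, a₁ < b₁ ∧ a₂ < b₂ ∧
          (R = {z : ℂ | z.re ∈ Set.Ioc (a₁ : ℝ) (b₁ : ℝ) ∧ z.im ∈ Set.Ioc (a₂ : ℝ) (b₂ : ℝ)} ∨
           R = {z : ℂ | z.re ∈ Set.Ico (a₁ : ℝ) (b₁ : ℝ) ∧ z.im ∈ Set.Ico (a₂ : ℝ) (b₂ : ℝ)}))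
        ∧ closure R ⊆ D}

section

open Set Topology BoundedContinuousFunction
open scoped NNReal

/-- A real sequence that is eventually within every `ε` of some convergent sequence converges. -/
lemma exists_tendsto_of_forall_approx {x : ℕ → ℝ}
    (h : ∀ ε > 0, ∃ (c : ℕ → ℝ) (l : ℝ), Tendsto c atTop (𝓝 l) ∧ ∀ᶠ k in atTop, |x k - c k| ≤ ε) :
    ∃ l, Tendsto x atTop (𝓝 l) := by
  apply cauchySeq_tendsto_of_complete
  rw [Metric.cauchySeq_iff']
  intro ε hε
  obtain ⟨c, l, hc, hx⟩ := h (ε / 8) (by positivity)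
  obtain ⟨N, hN⟩ := eventually_atTop.1 (hx.and (Metric.tendsto_nhds.1 hc (ε / 8) (by positivity)))
  refine ⟨N, fun n hn => ?_⟩
  have h1 := hN n hn
  have h2 := hN N le_rfl
  simp only [Real.dist_eq] at h1 h2 ⊢
  rw [abs_le, abs_lt] at h1 h2
  rw [abs_lt]
  constructor <;> linarith [h1.1.1, h1.1.2, h1.2.1, h1.2.2, h2.1.1, h2.1.2, h2.2.1, h2.2.2]

/-- Bisection: a property of rational intervals that holds for short subintervals of `[A, B]` and
passes from adjacent intervals to their union holds for `[A, B]`. -/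
lemma rat_interval_bisection {P : ℚ → ℚ → Prop} {A B δ : ℚ} (hδ : 0 < δ) (hAB : A < B)
    (small : ∀ a b, A ≤ a → a < b → b ≤ B → b - a ≤ δ → P a b)
    (union : ∀ a c b, A ≤ a → a < c → c < b → b ≤ B → P a c → P c b → P a b) : P A B := by
  have key : ∀ n : ℕ, ∀ a b, A ≤ a → a < b → b ≤ B → b - a ≤ δ * 2 ^ n → P a b := by
    intro n
    induction n with
    | zero => simpa using small
    | succ n ih =>
      intro a b ha hab hb h
      rw [pow_succ] at h
      exact union a ((a + b) / 2) b ha (by linarith) (by linarith) hb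
        (ih _ _ ha (by linarith) (by linarith) (by linarith))
        (ih _ _ (by linarith) (by linarith) hb (by linarith))
  obtain ⟨n, hn⟩ := pow_unbounded_of_one_lt ((B - A) / δ) (one_lt_two)
  refine key n A B le_rfl hAB le_rfl ?_
  rw [div_lt_iff₀ hδ] at hn
  linarith

/-- A function with values within `η` of `c` on `s` has integral over `s` within `η μ(s)`
of `c μ(s)`. -/
lemma abs_setIntegral_sub_mul_measureReal_le {X : Type*} [MeasurableSpace X] {μ : Measure X}
    [IsFiniteMeasure μ] {s : Set X} {f : X → ℝ} {c η : ℝ} (hf : IntegrableOn f s μ)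
    (h : ∀ x ∈ s, |f x - c| ≤ η) : |∫ x in s, f x ∂μ - c * μ.real s| ≤ η * μ.real s := by
  have h1 : ∫ x in s, f x ∂μ - c * μ.real s = ∫ x in s, (f x - c) ∂μ := by
    rw [integral_sub hf (integrable_const c), setIntegral_const, smul_eq_mul, mul_comm c]
  rw [h1, ← Real.norm_eq_abs]
  exact norm_setIntegral_le_of_norm_le_const (measure_lt_top _ _) h

/-- Tightness of a sequence of finite measures need only be checked eventually. -/
lemma isTightMeasureSet_range_of_eventually {X : Type*} [TopologicalSpace X] [PolishSpace X]
    [MeasurableSpace X] [BorelSpace X] {μ : ℕ → Measure X} [∀ k, IsFiniteMeasure (μ k)]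
    (h : ∀ ε : ENNReal, 0 < ε → ∃ K : Set X, IsCompact K ∧ ∀ᶠ k in atTop, μ k Kᶜ ≤ ε) :
    IsTightMeasureSet (range μ) := by
  rw [isTightMeasureSet_iff_exists_isCompact_measure_compl_le]
  intro ε hε
  obtain ⟨K, hK, hμ⟩ := h ε hε
  obtain ⟨N, hN⟩ := eventually_atTop.1 hμ
  have hsingle : ∀ k, ∃ K : Set X, IsCompact K ∧ μ k Kᶜ ≤ ε := fun k => by
    obtain ⟨K, hK, hμ⟩ := isTightMeasureSet_iff_exists_isCompact_measure_compl_le.1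
      (isTightMeasureSet_singleton (μ := μ k)) ε hε
    exact ⟨K, hK, hμ _ rfl⟩
  choose K' hK' hμ' using hsingle
  refine ⟨K ∪ ⋃ k ∈ Finset.range N, K' k,
    hK.union ((Finset.range N).isCompact_biUnion fun k _ => hK' k), ?_⟩
  rintro _ ⟨k, rfl⟩
  rcases le_or_gt N k with hk | hk
  · exact (measure_mono (compl_subset_compl.2 subset_union_left)).trans (hN k hk)
  · refine (measure_mono (compl_subset_compl.2 ?_)).trans (hμ' k)
    exact (subset_biUnion_of_mem (u := K') (Finset.mem_coe.2 (Finset.mem_range.2 hk))).trans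
      subset_union_right

/-- A tight sequence of finite measures with bounded masses, along which the integral of each
bounded continuous function converges, has a weak limit. -/
lemma exists_finiteMeasure_tendsto_integral {X : Type*} [TopologicalSpace X] [T2Space X]
    [NormalSpace X] [MeasurableSpace X] [BorelSpace X] {μ : ℕ → FiniteMeasure X} {C : ℝ≥0}
    (hC : ∀ k, (μ k).mass ≤ C)
    (htight : IsTightMeasureSet (range fun k => (μ k : Measure X)))
    (hconv : ∀ φ : X →ᵇ ℝ, ∃ l, Tendsto (fun k => ∫ x, φ x ∂(μ k : Measure X)) atTop (𝓝 l)) :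
    ∃ ν : FiniteMeasure X, ∀ φ : X →ᵇ ℝ,
      Tendsto (fun k => ∫ x, φ x ∂(μ k : Measure X)) atTop (𝓝 (∫ x, φ x ∂(ν : Measure X))) := by
  obtain ⟨u, -, u_pos, u_lim⟩ := exists_seq_strictAnti_tendsto (0 : ℝ≥0)
  have hK : ∀ n, ∃ K : Set X, IsCompact K ∧ ∀ k, (μ k) Kᶜ ≤ u n := fun n => by
    obtain ⟨K, hK, hμ⟩ := isTightMeasureSet_iff_exists_isCompact_measure_compl_le.1 htight (u n)
      (by exact_mod_cast u_pos n)
    refine ⟨K, hK, fun k => ?_⟩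
    have := hμ _ ⟨k, rfl⟩
    exact ENNReal.coe_le_coe.1 (by simpa using this)
  choose K hK hμK using hK
  have hcomp := isCompact_setOfPred_finiteMeasure_mass_le_compl_isCompact_le C u_lim hK
    (Or.inl inferInstance)
  obtain ⟨ν, -, hν⟩ := hcomp.exists_mapClusterPt (f := atTop) (u := μ)
    (tendsto_principal.2 (Eventually.of_forall fun k => ⟨hC k, fun n => hμK n k⟩))
  refine ⟨ν, fun φ => ?_⟩
  obtain ⟨l, hl⟩ := hconv φ
  have h1 : MapClusterPt (∫ x, φ x ∂(ν : Measure X)) atTop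
      (fun k => ∫ x, φ x ∂(μ k : Measure X)) :=
    hν.continuousAt_comp
      (FiniteMeasure.continuous_integral_boundedContinuousFunction φ).continuousAt
  have h2 : ClusterPt (∫ x, φ x ∂(ν : Measure X)) (𝓝 l) := ClusterPt.mono h1 hl
  rwa [eq_of_nhds_neBot h2]

/-- `φ` has, up to relative error `η`, asymptotically convergent integrals over `R`. -/
def ApproxConvergentOn (μ : ℕ → Measure ℂ) (φ : ℂ → ℝ) (η : ℝ) (R : Set ℂ) : Prop :=
  ∃ (c : ℕ → ℝ) (l : ℝ), Tendsto c atTop (𝓝 l) ∧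
    ∀ k, |∫ z in R, φ z ∂(μ k) - c k| ≤ η * (μ k).real R

lemma ApproxConvergentOn.union {μ : ℕ → Measure ℂ} [∀ k, IsFiniteMeasure (μ k)] {φ : ℂ → ℝ}
    {η : ℝ} {R S : Set ℂ} (hR : ApproxConvergentOn μ φ η R) (hS : ApproxConvergentOn μ φ η S)
    (hRS : Disjoint R S) (hSm : MeasurableSet S) (hφR : ∀ k, IntegrableOn φ R (μ k))
    (hφS : ∀ k, IntegrableOn φ S (μ k)) : ApproxConvergentOn μ φ η (R ∪ S) := by
  obtain ⟨c, l, hc, hcR⟩ := hR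
  obtain ⟨d, m, hd, hdS⟩ := hS
  refine ⟨fun k => c k + d k, l + m, hc.add hd, fun k => ?_⟩
  rw [setIntegral_union hRS hSm (hφR k) (hφS k), measureReal_union hRS hSm, mul_add]
  calc _ = |(∫ z in R, φ z ∂(μ k) - c k) + (∫ z in S, φ z ∂(μ k) - d k)| := by ring_nf
    _ ≤ _ := (abs_add_le _ _).trans (add_le_add (hcR k) (hdS k))

/-- Every rectangle in `ℛ` is a product of two intervals of the same half-open kind. -/
lemma exists_eq_reProdIm_of_mem {D R : Set ℂ} (hR : R ∈ rationalRectanglesIn D) :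
    ∃ I : ℝ → ℝ → Set ℝ, (I = Ioc ∨ I = Ico) ∧ ∃ a₁ b₁ a₂ b₂ : ℚ, a₁ < b₁ ∧ a₂ < b₂ ∧
      R = I a₁ b₁ ×ℂ I a₂ b₂ := by
  obtain ⟨⟨a₁, b₁, a₂, b₂, h₁, h₂, rfl | rfl⟩, -⟩ := hR
  · exact ⟨Ioc, Or.inl rfl, a₁, b₁, a₂, b₂, h₁, h₂, rfl⟩
  · exact ⟨Ico, Or.inr rfl, a₁, b₁, a₂, b₂, h₁, h₂, rfl⟩

lemma reProdIm_mem_rationalRectanglesIn {D : Set ℂ} {I : ℝ → ℝ → Set ℝ} (hI : I = Ioc ∨ I = Ico)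
    {a₁ b₁ a₂ b₂ : ℚ} (h₁ : a₁ < b₁) (h₂ : a₂ < b₂)
    (hD : closure (I a₁ b₁ ×ℂ I a₂ b₂) ⊆ D) :
    I a₁ b₁ ×ℂ I a₂ b₂ ∈ rationalRectanglesIn D := by
  refine ⟨⟨a₁, b₁, a₂, b₂, h₁, h₂, ?_⟩, hD⟩
  rcases hI with rfl | rfl
  · exact Or.inl rfl
  · exact Or.inr rfl

lemma measurableSet_of_mem_rationalRectanglesIn {D R : Set ℂ} (hR : R ∈ rationalRectanglesIn D) :
    MeasurableSet R := by
  obtain ⟨I, rfl | rfl, a₁, b₁, a₂, b₂, -, -, rfl⟩ := exists_eq_reProdIm_of_mem hR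
  · exact (measurableSet_Ioc.preimage Complex.measurable_re).inter
      (measurableSet_Ioc.preimage Complex.measurable_im)
  · exact (measurableSet_Ico.preimage Complex.measurable_re).inter
      (measurableSet_Ico.preimage Complex.measurable_im)

/-- Elementary facts on half-open intervals of a fixed kind. -/
lemma halfOpen_interval_facts {I : ℝ → ℝ → Set ℝ} (hI : I = Ioc ∨ I = Ico) :
    (∀ a b, MeasurableSet (I a b)) ∧ (∀ a b, a < b → (I a b).Nonempty) ∧
    (∀ a b, I a b ⊆ Icc a b) ∧ (∀ a b a' b', a' ≤ a → b ≤ b' → I a b ⊆ I a' b') ∧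
    (∀ a c b, a < c → c < b → I a c ∪ I c b = I a b ∧ Disjoint (I a c) (I c b)) := by
  rcases hI with rfl | rfl
  · exact ⟨fun _ _ => measurableSet_Ioc, fun _ _ => nonempty_Ioc.2, fun _ _ => Ioc_subset_Icc_self,
      fun _ _ _ _ => Ioc_subset_Ioc, fun _ _ _ h h' =>
      ⟨Ioc_union_Ioc_eq_Ioc h.le h'.le, Ioc_disjoint_Ioc_of_le le_rfl⟩⟩
  · exact ⟨fun _ _ => measurableSet_Ico, fun _ _ => nonempty_Ico.2, fun _ _ => Ico_subset_Icc_self,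
      fun _ _ _ _ => Ico_subset_Ico, fun _ _ _ h h' =>
      ⟨Ico_union_Ico_eq_Ico h.le h'.le, Ico_disjoint_Ico_same⟩⟩

/-- If the masses of all rectangles in `ℛ` converge, so do the integrals over each rectangle
in `ℛ` of any continuous function. -/
lemma exists_tendsto_setIntegral_of_mem_rationalRectanglesIn {D : Set ℂ}
    (hDbdd : Bornology.IsBounded D) {μ : ℕ → Measure ℂ} [∀ k, IsFiniteMeasure (μ k)]
    {L : Set ℂ → ℝ}
    (hL : ∀ R ∈ rationalRectanglesIn D, Tendsto (fun k => (μ k).real R) atTop (𝓝 (L R)))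
    {φ : ℂ → ℝ} (hφ : ContinuousOn φ D) {R : Set ℂ} (hR : R ∈ rationalRectanglesIn D) :
    ∃ l, Tendsto (fun k => ∫ z in R, φ z ∂(μ k)) atTop (𝓝 l) := by
  have hRD : closure R ⊆ D := hR.2
  have hRcomp : IsCompact (closure R) :=
    (hDbdd.subset (subset_closure.trans hRD)).isCompact_closure
  have hint : ∀ S ⊆ R, ∀ k, IntegrableOn φ S (μ k) := fun S hS k =>
    ((hφ.mono hRD).integrableOn_compact hRcomp).mono_set (hS.trans subset_closure)
  have key : ∀ η > 0, ApproxConvergentOn μ φ η R := by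
    intro η hη
    obtain ⟨δ, hδ, hunif⟩ := Metric.uniformContinuousOn_iff.1
      (hRcomp.uniformContinuousOn_of_continuous (hφ.mono hRD)) η hη
    obtain ⟨δ', hδ'0, hδ'⟩ := exists_rat_btwn (half_pos hδ)
    obtain ⟨I, hI, A₁, B₁, A₂, B₂, h₁, h₂, rfl⟩ := exists_eq_reProdIm_of_mem hR
    obtain ⟨hmeas, hne, hIcc, hmono, hsplit⟩ := halfOpen_interval_facts hI
    have hm : ∀ a b c d : ℝ, MeasurableSet (I a b ×ℂ I c d) := fun a b c d =>
      ((hmeas a b).preimage Complex.measurable_re).inter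
        ((hmeas c d).preimage Complex.measurable_im)
    have hsub : ∀ a b c d : ℚ, A₁ ≤ a → b ≤ B₁ → A₂ ≤ c → d ≤ B₂ →
        I a b ×ℂ I c d ⊆ I A₁ B₁ ×ℂ I A₂ B₂ := fun a b c d ha hb hc hd =>
      inter_subset_inter
        (preimage_mono (hmono _ _ _ _ (by exact_mod_cast ha) (by exact_mod_cast hb)))
        (preimage_mono (hmono _ _ _ _ (by exact_mod_cast hc) (by exact_mod_cast hd)))
    have hδ'pos : 0 < δ' := by exact_mod_cast hδ'0
    refine rat_interval_bisection (P := fun a b => ApproxConvergentOn μ φ η (I a b ×ℂ I A₂ B₂))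
      hδ'pos h₁ (fun a b ha hab hb hδab => ?_) (fun a c b ha hac hcb hb hP hQ => ?_)
    · refine rat_interval_bisection (P := fun c d => ApproxConvergentOn μ φ η (I a b ×ℂ I c d))
        hδ'pos h₂ (fun c d hc hcd hd hδcd => ?_) (fun c e d hc hce hed hd hP hQ => ?_)
      · have hS := hsub a b c d ha hb hc hd
        have hSmem : I a b ×ℂ I c d ∈ rationalRectanglesIn D :=
          reProdIm_mem_rationalRectanglesIn hI hab hcd ((closure_mono hS).trans hRD)
        obtain ⟨x, hx⟩ := hne a b (by exact_mod_cast hab)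
        obtain ⟨y, hy⟩ := hne c d (by exact_mod_cast hcd)
        have hz₀ : (⟨x, y⟩ : ℂ) ∈ I a b ×ℂ I c d := ⟨hx, hy⟩
        refine ⟨fun k => φ ⟨x, y⟩ * (μ k).real (I a b ×ℂ I c d), _,
          (hL _ hSmem).const_mul _, fun k => ?_⟩
        refine abs_setIntegral_sub_mul_measureReal_le (hint _ hS k) fun z hz => ?_
        refine (hunif z (subset_closure (hS hz)) _ (subset_closure (hS hz₀)) ?_).le
        have hre := Real.dist_le_of_mem_Icc (hIcc _ _ hz.1) (hIcc _ _ hx)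
        have him := Real.dist_le_of_mem_Icc (hIcc _ _ hz.2) (hIcc _ _ hy)
        rw [Real.dist_eq] at hre him
        have hab' : (b : ℝ) - a ≤ δ' := by exact_mod_cast hδab
        have hcd' : (d : ℝ) - c ≤ δ' := by exact_mod_cast hδcd
        calc dist z ⟨x, y⟩ = ‖z - ⟨x, y⟩‖ := dist_eq_norm _ _
          _ ≤ |z.re - x| + |z.im - y| := Complex.norm_le_abs_re_add_abs_im _
          _ < δ := by linarith
      · obtain ⟨hu, hdisj⟩ := hsplit c e d (by exact_mod_cast hce) (by exact_mod_cast hed)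
        have : I a b ×ℂ I c d = I a b ×ℂ I c e ∪ I a b ×ℂ I e d := by
          rw [← hu]
          exact inter_union_distrib_left ..
        rw [this]
        exact hP.union hQ ((hdisj.preimage Complex.im).mono inter_subset_right inter_subset_right)
          (hm _ _ _ _) (hint _ (hsub a b c e ha hb hc (hed.le.trans hd)))
          (hint _ (hsub a b e d ha hb (hc.trans hce.le) hd))
    · obtain ⟨hu, hdisj⟩ := hsplit a c b (by exact_mod_cast hac) (by exact_mod_cast hcb)
      have : I a b ×ℂ I A₂ B₂ = I a c ×ℂ I A₂ B₂ ∪ I c b ×ℂ I A₂ B₂ := by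
        rw [← hu]
        exact union_inter_distrib_right ..
      rw [this]
      exact hP.union hQ ((hdisj.preimage Complex.re).mono inter_subset_left inter_subset_left)
        (hm _ _ _ _) (hint _ (hsub a c A₂ B₂ ha (hcb.le.trans hb) le_rfl le_rfl))
        (hint _ (hsub c b A₂ B₂ (ha.trans hac.le) hb le_rfl le_rfl))
  refine exists_tendsto_of_forall_approx fun ε hε => ?_
  have hpos : 0 < |L R| + 1 := by positivity
  obtain ⟨c, l, hc, hck⟩ := key (ε / (|L R| + 1)) (by positivity)
  refine ⟨c, l, hc, ?_⟩
  filter_upwards [(hL R hR).eventually_le_const (lt_of_le_of_lt (le_abs_self _) (lt_add_one _))]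
    with k hk
  calc _ ≤ ε / (|L R| + 1) * (μ k).real R := hck k
    _ ≤ ε / (|L R| + 1) * (|L R| + 1) := by gcongr
    _ = ε := div_mul_cancel₀ _ hpos.ne'

/-- If the masses of `D` are exhausted by disjoint rectangles in `ℛ`, these rectangles
eventually carry all but `ε` of the mass of `μ_k`. -/
lemma exists_rectangles_measureReal_sdiff_lt {D : Set ℂ} {μ : ℕ → Measure ℂ}
    [∀ k, IsFiniteMeasure (μ k)] {L : Set ℂ → ℝ}
    (hL : ∀ R ∈ rationalRectanglesIn D, Tendsto (fun k => (μ k).real R) atTop (𝓝 (L R)))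
    (hLD : Tendsto (fun k => (μ k).real D) atTop (𝓝 (L D)))
    (hsup : L D = sSup {x : ℝ | ∃ (m : ℕ) (R : Fin m → Set ℂ), 1 ≤ m ∧
      (∀ i, R i ∈ rationalRectanglesIn D) ∧ Pairwise (Function.onFun Disjoint R) ∧
      x = ∑ i, L (R i)}) {ε : ℝ} (hε : 0 < ε) :
    ∃ (m : ℕ) (R : Fin m → Set ℂ), (∀ i, R i ∈ rationalRectanglesIn D) ∧
      Pairwise (Function.onFun Disjoint R) ∧
      ∀ᶠ k in atTop, (μ k).real (D \ ⋃ i, R i) < ε := by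
  obtain ⟨m, R, hR, hdisj, hlt⟩ : ∃ (m : ℕ) (R : Fin m → Set ℂ),
      (∀ i, R i ∈ rationalRectanglesIn D) ∧ Pairwise (Function.onFun Disjoint R) ∧
      L D - ε < ∑ i, L (R i) := by
    rcases eq_empty_or_nonempty {x : ℝ | ∃ (m : ℕ) (R : Fin m → Set ℂ), 1 ≤ m ∧
      (∀ i, R i ∈ rationalRectanglesIn D) ∧ Pairwise (Function.onFun Disjoint R) ∧
      x = ∑ i, L (R i)} with h | h
    · rw [h, Real.sSup_empty] at hsup
      exact ⟨0, Fin.elim0, fun i => i.elim0, fun i => i.elim0, by simpa [hsup] using hε⟩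
    · obtain ⟨x, ⟨m, R, -, hR, hdisj, rfl⟩, hx⟩ :=
        exists_lt_of_lt_csSup h (show L D - ε < _ by rw [← hsup]; linarith)
      exact ⟨m, R, hR, hdisj, hx⟩
  refine ⟨m, R, hR, hdisj, ?_⟩
  have hlim := hLD.sub (tendsto_finsetSum Finset.univ fun i _ => hL (R i) (hR i))
  filter_upwards [hlim.eventually_lt_const (show _ < ε by linarith)] with k hk
  have hm : ∀ i, MeasurableSet (R i) := fun i => measurableSet_of_mem_rationalRectanglesIn (hR i)
  rwa [measureReal_sdiff (iUnion_subset fun i => subset_closure.trans (hR i).2)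
    (MeasurableSet.iUnion hm), measureReal_iUnion_fintype hdisj hm]

/-- Under the mass convergence and exhaustion by rectangles, the integrals over `D` of any
bounded continuous function converge. -/
lemma exists_tendsto_setIntegral_of_rectangles {D : Set ℂ} (hDm : MeasurableSet D)
    (hDbdd : Bornology.IsBounded D) {μ : ℕ → Measure ℂ} [∀ k, IsFiniteMeasure (μ k)]
    {L : Set ℂ → ℝ}
    (hL : ∀ R ∈ rationalRectanglesIn D, Tendsto (fun k => (μ k).real R) atTop (𝓝 (L R)))
    (hexh : ∀ ε > 0, ∃ (m : ℕ) (R : Fin m → Set ℂ), (∀ i, R i ∈ rationalRectanglesIn D) ∧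
      Pairwise (Function.onFun Disjoint R) ∧ ∀ᶠ k in atTop, (μ k).real (D \ ⋃ i, R i) < ε)
    {φ : ℂ → ℝ} (hφ : ContinuousOn φ D) {M : ℝ} (hM : ∀ z ∈ D, |φ z| ≤ M) :
    ∃ l, Tendsto (fun k => ∫ z in D, φ z ∂(μ k)) atTop (𝓝 l) := by
  have hint : ∀ k, IntegrableOn φ D (μ k) := fun k =>
    Integrable.of_bound (hφ.aestronglyMeasurable hDm) M
      ((ae_restrict_iff' hDm).2 (Eventually.of_forall hM))
  refine exists_tendsto_of_forall_approx fun ε hε => ?_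
  have hpos : 0 < |M| + 1 := by positivity
  obtain ⟨m, R, hR, hdisj, hμ⟩ := hexh (ε / (|M| + 1)) (by positivity)
  have hRD : ∀ i, R i ⊆ D := fun i => subset_closure.trans (hR i).2
  have hRm : ∀ i, MeasurableSet (R i) := fun i => measurableSet_of_mem_rationalRectanglesIn (hR i)
  choose l hl using fun i =>
    exists_tendsto_setIntegral_of_mem_rationalRectanglesIn hDbdd hL hφ (hR i)
  refine ⟨_, _, tendsto_finsetSum Finset.univ fun i _ => hl i, ?_⟩
  filter_upwards [hμ] with k hk
  rw [← integral_iUnion_fintype hRm hdisj fun i => (hint k).mono_set (hRD i),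
    ← setIntegral_sdiff (MeasurableSet.iUnion hRm) (hint k) (iUnion_subset hRD)]
  calc |∫ z in D \ ⋃ i, R i, φ z ∂(μ k)| ≤ (|M| + 1) * (μ k).real (D \ ⋃ i, R i) := by
        rw [← Real.norm_eq_abs]
        exact norm_setIntegral_le_of_norm_le_const (measure_lt_top _ _) fun z hz =>
          (hM z hz.1).trans ((le_abs_self M).trans (lt_add_one _).le)
    _ ≤ (|M| + 1) * (ε / (|M| + 1)) := by gcongr
    _ = ε := mul_div_cancel₀ _ hpos.ne'

/-- If rectangles in `ℛ` eventually carry all but `ε` of the mass of `μ_k`, the sequence `μ_k` is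
tight on `D`. -/
lemma isTightMeasureSet_range_comap_of_rectangles {D : Set ℂ} (hDopen : IsOpen D)
    (hDbdd : Bornology.IsBounded D) {μ : ℕ → Measure ℂ} [∀ k, IsFiniteMeasure (μ k)]
    (hexh : ∀ ε > 0, ∃ (m : ℕ) (R : Fin m → Set ℂ), (∀ i, R i ∈ rationalRectanglesIn D) ∧
      Pairwise (Function.onFun Disjoint R) ∧ ∀ᶠ k in atTop, (μ k).real (D \ ⋃ i, R i) < ε) :
    IsTightMeasureSet (range fun k => (μ k).comap (Subtype.val : D → ℂ)) := by
  have : PolishSpace D := hDopen.polishSpace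
  refine isTightMeasureSet_range_of_eventually fun ε hε => ?_
  obtain ⟨ε', hε', hlt⟩ := ENNReal.lt_iff_exists_real_btwn.1 hε
  obtain ⟨m, R, hR, -, hμ⟩ := hexh ε' (ENNReal.ofReal_pos.1 hlt.1)
  have hcomp : IsCompact (⋃ i, closure (R i)) := isCompact_iUnion fun i =>
    (hDbdd.subset (subset_closure.trans (hR i).2)).isCompact_closure
  refine ⟨Subtype.val ⁻¹' ⋃ i, closure (R i), Topology.IsInducing.subtypeVal.isCompact_preimage'
    hcomp (by simpa using fun i => (hR i).2), ?_⟩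
  filter_upwards [hμ] with k hk
  rw [comap_subtype_coe_apply hDopen.measurableSet]
  calc _ ≤ μ k (D \ ⋃ i, R i) := measure_mono (by
        rintro _ ⟨z, hz, rfl⟩
        exact ⟨z.2, fun h => hz (iUnion_mono (fun i => subset_closure) h)⟩)
    _ = ENNReal.ofReal ((μ k).real (D \ ⋃ i, R i)) := (ofReal_measureReal).symm
    _ ≤ ENNReal.ofReal ε' := ENNReal.ofReal_le_ofReal hk.le
    _ ≤ ε := hlt.2.le

end

/-- Let `D ⊆ ℂ` be bounded and open, and let `(μ_k)` be finite Borel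
measures carried by `D` such that: (i) `μ_k R → L R` for every rectangle `R ∈ ℛ`;
(ii) `μ_k D → L D`; (iii) `L D` is the supremum of the sums `∑ L(R_i)` over finite
pairwise-disjoint families of rectangles in `ℛ`.  Then `μ_k` converges weakly to a finite
Borel measure `μ` carried by `D`: `∫_D φ dμ_k → ∫_D φ dμ` for all bounded continuous
`φ : D → ℝ`. -/
theorem weak_convergence_from_rectangles
    (D : Set ℂ) (hDopen : IsOpen D) (hDbdd : Bornology.IsBounded D)
    (μ : ℕ → Measure ℂ) (hfin : ∀ k, IsFiniteMeasure (μ k))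
    (hsupp : ∀ k, μ k Dᶜ = 0)
    (L : Set ℂ → ℝ)
    (hR : ∀ R ∈ rationalRectanglesIn D,
      Tendsto (fun k => (μ k R).toReal) atTop (nhds (L R)))
    (hD : Tendsto (fun k => (μ k D).toReal) atTop (nhds (L D)))
    (hsup : L D = sSup {x : ℝ | ∃ (m : ℕ) (R : Fin m → Set ℂ), 1 ≤ m ∧
      (∀ i, R i ∈ rationalRectanglesIn D) ∧ Pairwise (Function.onFun Disjoint R) ∧
      x = ∑ i, L (R i)}) :
    ∃ ν : Measure ℂ, IsFiniteMeasure ν ∧ ν Dᶜ = 0 ∧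
      ∀ φ : ℂ → ℝ, ContinuousOn φ D → (∃ M : ℝ, ∀ z ∈ D, |φ z| ≤ M) →
        Tendsto (fun k => ∫ z in D, φ z ∂(μ k)) atTop (nhds (∫ z in D, φ z ∂ν)) := by
  have hDm := hDopen.measurableSet
  have hemb := MeasurableEmbedding.subtype_coe hDm
  have hexh := fun (ε : ℝ) (hε : 0 < ε) => exists_rectangles_measureReal_sdiff_lt hR hD hsup hε
  obtain ⟨C, hC⟩ := hD.bddAbove_range
  have hmass : ∀ k, (μ k).comap (Subtype.val : D → ℂ) Set.univ = μ k D := fun k => by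
    rw [comap_subtype_coe_apply hDm, Set.image_univ, Subtype.range_coe]
  have hfin' : ∀ k, IsFiniteMeasure ((μ k).comap (Subtype.val : D → ℂ)) := fun k =>
    ⟨by rw [hmass]; exact measure_lt_top _ _⟩
  let μD : ℕ → FiniteMeasure D := fun k => ⟨(μ k).comap Subtype.val, hfin' k⟩
  obtain ⟨ν, hν⟩ := exists_finiteMeasure_tendsto_integral (μ := μD) (C := C.toNNReal)
    (fun k => by
      rw [← NNReal.coe_le_coe]
      calc ((μD k).mass : ℝ) = (μ k D).toReal := congrArg ENNReal.toReal (hmass k)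
        _ ≤ C := hC ⟨k, rfl⟩
        _ ≤ C.toNNReal := Real.le_coe_toNNReal C)
    (isTightMeasureSet_range_comap_of_rectangles hDopen hDbdd hexh)
    (fun φ => by
      have hext : ∀ z : D, Function.extend Subtype.val φ 0 (z : ℂ) = φ z :=
        Subtype.val_injective.extend_apply φ 0
      obtain ⟨l, hl⟩ := exists_tendsto_setIntegral_of_rectangles hDm hDbdd hR hexh
        (φ := Function.extend Subtype.val φ 0) (M := ‖φ‖)
        (continuousOn_iff_continuous_domRestrict.2 (φ.continuous.congr fun z => (hext z).symm))
        (fun z hz => (hext ⟨z, hz⟩).symm ▸ φ.norm_coe_le_norm ⟨z, hz⟩)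
      refine ⟨l, hl.congr fun k => ?_⟩
      rw [← integral_subtype_comap hDm]
      exact integral_congr_ae (Eventually.of_forall hext))
  refine ⟨(ν : Measure D).map Subtype.val, inferInstance, ?_, ?_⟩
  · rw [hemb.map_apply]
    simp
  · rintro φ hφ ⟨M, hM⟩
    have h := hν (BoundedContinuousFunction.ofNormedAddCommGroup (D.domRestrict φ)
      hφ.domRestrict M fun z => hM z z.2)
    rw [← integral_subtype_comap hDm, hemb.comap_map]
    exact h.congr fun k => integral_subtype_comap hDm φ
end
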